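/- Let n > 1, k ≥ 3, and let g_1, …, g_n ∈ C_0^k(M^n, 𝔸) have compact support. Suppose that g_j(x) = −∂̄_j ( ∫_M E(y_1) g_1(y_1 + x_1, x^0) dV(y_1) ) for all j = 2, …, n and all x = (x_1, x^0) ∈ M^n. Then the function f(x) := −∫_M E(y_1 − x_1) g_1(y_1, x^0) dV(y_1) belongs to C^k(M^n, 𝔸), has compact support, satisfies ∂̄_j f = g_j on M^n for all j = 1, …, n, and vanishes on the unbounded connected component of M^n ∖ (supp g_1 ∪ ⋯ ∪ supp g_n). -/

import Mathlib

open MeasureTheory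

noncomputable section

/-- A real alternative `*`-algebra of finite dimension `> 1`, with a fixed
hypercomplex basis `v 0 = 1, v 1, …, v m` spanning the hypercomplex subspace `M`.
Multiplication is `ℝ`-bilinear (bundled as a linear map). -/
structure HCAlg (𝔸 : Type) [NormedAddCommGroup 𝔸] [NormedSpace ℝ 𝔸] (m : ℕ) : Type where
  mul : 𝔸 →ₗ[ℝ] 𝔸 →ₗ[ℝ] 𝔸
  one : 𝔸
  conj : 𝔸 →ₗ[ℝ] 𝔸
  findim : FiniteDimensional ℝ 𝔸
  dim_gt_one : 1 < Module.finrank ℝ 𝔸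
  one_mul' : ∀ a, mul one a = a
  mul_one' : ∀ a, mul a one = a
  alt_left : ∀ a b, mul a (mul a b) = mul (mul a a) b
  alt_right : ∀ a b, mul (mul b a) a = mul b (mul a a)
  conj_invol : ∀ a, conj (conj a) = a
  conj_mul' : ∀ a b, conj (mul a b) = mul (conj b) (conj a)
  conj_one : conj one = one
  hm : 1 ≤ m
  v : Fin (m + 1) → 𝔸
  v_indep : LinearIndependent ℝ v
  v_zero : v 0 = one
  v_trace : ∀ s, s ≠ 0 → v s + conj (v s) = 0
  v_norm : ∀ s, s ≠ 0 → mul (v s) (conj (v s)) = one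
  v_anticomm : ∀ s t, s ≠ 0 → t ≠ 0 → s ≠ t → mul (v s) (v t) = -(mul (v t) (v s))

variable {𝔸 : Type} [NormedAddCommGroup 𝔸] [NormedSpace ℝ 𝔸] {m n : ℕ}

/-- `M^n`, identified with `ℝ^{(m+1)n}` via the coordinates `x j s`. -/
abbrev Mn (n m : ℕ) := Fin n → Fin (m + 1) → ℝ

/-- Euclidean norm of a point of `M` (in coordinates). -/
def enormM (c : Fin (m + 1) → ℝ) : ℝ := Real.sqrt (∑ s, c s ^ 2)

/-- Euclidean norm of a point of `M^n` (in coordinates). -/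
def enormMn (x : Mn n m) : ℝ := Real.sqrt (∑ j, ∑ s, x j s ^ 2)

/-- Partial derivative `∂f/∂x_{j,s}` for functions on `M^n`. -/
def pd {E : Type} [NormedAddCommGroup E] [NormedSpace ℝ E]
    (f : Mn n m → E) (j : Fin n) (s : Fin (m + 1)) (x : Mn n m) : E :=
  fderiv ℝ f x (Pi.single j (Pi.single s 1))

/-- Partial derivative `∂f/∂x_s` for functions on `M`. -/
def pd1 {E : Type} [NormedAddCommGroup E] [NormedSpace ℝ E]
    (f : (Fin (m + 1) → ℝ) → E) (s : Fin (m + 1)) (x : Fin (m + 1) → ℝ) : E :=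
  fderiv ℝ f x (Pi.single s 1)

/-- The Dirac (Cauchy–Riemann) operator `∂̄_j = ∑_s v_s ∂/∂x_{j,s}`. -/
def dbar (H : HCAlg 𝔸 m) (f : Mn n m → 𝔸) (j : Fin n) (x : Mn n m) : 𝔸 :=
  ∑ s, H.mul (H.v s) (pd f j s x)

/-- The conjugated Dirac operator `∂_j = ∑_s v_s^c ∂/∂x_{j,s}`. -/
def dconj (H : HCAlg 𝔸 m) (f : Mn n m → 𝔸) (j : Fin n) (x : Mn n m) : 𝔸 :=
  ∑ s, H.mul (H.conj (H.v s)) (pd f j s x)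

/-- The Laplacian `Δ_j = ∑_s ∂²/∂x_{j,s}²` in the `j`-th block of variables. -/
def lap {E : Type} [NormedAddCommGroup E] [NormedSpace ℝ E]
    (f : Mn n m → E) (j : Fin n) (x : Mn n m) : E :=
  ∑ s, pd (pd f j s) j s x

/-- Surface area of the unit `(N-1)`-sphere in `ℝ^N`: `σ_N = 2 π^{N/2} / Γ(N/2)`. -/
def usigma (N : ℕ) : ℝ := 2 * Real.pi ^ ((N : ℝ) / 2) / Real.Gamma ((N : ℝ) / 2)

/-- Embedding of coordinates into the hypercomplex subspace `M ⊆ 𝔸`. -/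
def embM (H : HCAlg 𝔸 m) (c : Fin (m + 1) → ℝ) : 𝔸 := ∑ s, c s • H.v s

/-- The Cauchy kernel `E(x) = σ_{m+1}⁻¹ x^c / |x|^{m+1}` on `M`. -/
def CauchyE (H : HCAlg 𝔸 m) (c : Fin (m + 1) → ℝ) : 𝔸 :=
  (usigma (m + 1) * enormM c ^ (m + 1))⁻¹ • H.conj (embM H c)

/-- The Bochner–Martinelli kernel components `K_j(x) = σ_N⁻¹ x_j^c / |x|^N`, `N = (m+1)n`. -/
def Kker (H : HCAlg 𝔸 m) (n : ℕ) (j : Fin n) (x : Mn n m) : 𝔸 :=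
  (usigma ((m + 1) * n) * enormMn x ^ ((m + 1) * n))⁻¹ • H.conj (embM H (x j))

/-- `Tsol g (x) = −∫_M E(y₁ − x₁) (g(y₁, x⁰)) dV(y₁)`. -/
def Tsol (H : HCAlg 𝔸 m) (hn : 0 < n) (g : Mn n m → 𝔸) (x : Mn n m) : 𝔸 :=
  - ∫ y1 : Fin (m + 1) → ℝ,
      H.mul (CauchyE H (y1 - x ⟨0, hn⟩)) (g (Function.update x ⟨0, hn⟩ y1))

/-- `Fint g (x) = ∫_M E(y₁) (g(y₁ + x₁, x⁰)) dV(y₁)`. -/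
def Fint (H : HCAlg 𝔸 m) (hn : 0 < n) (g : Mn n m → 𝔸) (x : Mn n m) : 𝔸 :=
  ∫ y1 : Fin (m + 1) → ℝ,
      H.mul (CauchyE H y1) (g (Function.update x ⟨0, hn⟩ (y1 + x ⟨0, hn⟩)))

/-! ### The scalar components of the Cauchy kernel -/

/-- The scalar component `y_s / (σ |y|^{m+1})` of the Cauchy kernel. -/
def cauchyComp (s : Fin (m + 1)) (y : Fin (m + 1) → ℝ) : ℝ :=
  (usigma (m + 1))⁻¹ * (y s * (∑ i, y i ^ 2) ^ (-((m + 1 : ℕ) : ℝ) / 2))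

/-- The smooth regularization of `cauchyComp` in which `|y|²` is replaced by `|y|² + ε²`. -/
def cauchyCompReg (ε : ℝ) (s : Fin (m + 1)) (y : Fin (m + 1) → ℝ) : ℝ :=
  (usigma (m + 1))⁻¹ * (y s * (∑ i, y i ^ 2 + ε ^ 2) ^ (-((m + 1 : ℕ) : ℝ) / 2))

theorem usigma_pos {N : ℕ} (hN : 0 < N) : 0 < usigma N := by
  unfold usigma
  have : 0 < Real.Gamma ((N : ℝ) / 2) := Real.Gamma_pos_of_pos (by positivity)
  positivity

theorem CauchyE_eq_sum (H : HCAlg 𝔸 m) (y : Fin (m + 1) → ℝ) :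
    CauchyE H y = ∑ s, cauchyComp s y • H.conj (H.v s) := by
  have h : (enormM y ^ (m + 1))⁻¹ = (∑ i, y i ^ 2) ^ (-((m + 1 : ℕ) : ℝ) / 2) := by
    have h0 : 0 ≤ ∑ i, y i ^ 2 := by positivity
    rw [enormM, Real.sqrt_eq_rpow, ← Real.rpow_natCast, ← Real.rpow_mul h0, ← Real.rpow_neg h0]
    congr 1
    ring
  simp only [CauchyE, embM, cauchyComp, map_sum, map_smul, Finset.smul_sum, smul_smul, mul_inv, h]
  refine Finset.sum_congr rfl fun s _ => ?_
  congr 1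
  ring

theorem sum_sq_pos {ι : Type*} [Fintype ι] {y : ι → ℝ} (hy : y ≠ 0) : 0 < ∑ i, y i ^ 2 := by
  obtain ⟨i, hi⟩ := Function.ne_iff.mp hy
  exact Finset.sum_pos' (fun _ _ => sq_nonneg _) ⟨i, Finset.mem_univ _, sq_pos_iff.2 hi⟩

theorem norm_sq_le_sum_sq {ι : Type*} [Fintype ι] (y : ι → ℝ) : ‖y‖ ^ 2 ≤ ∑ i, y i ^ 2 := by
  have h : ‖y‖ ≤ Real.sqrt (∑ i, y i ^ 2) := by
    refine (pi_norm_le_iff_of_nonneg (Real.sqrt_nonneg _)).2 fun i => ?_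
    rw [Real.norm_eq_abs]
    exact Real.abs_le_sqrt (Finset.single_le_sum (f := fun i => y i ^ 2)
      (fun _ _ => sq_nonneg _) (Finset.mem_univ i))
  calc ‖y‖ ^ 2 ≤ Real.sqrt (∑ i, y i ^ 2) ^ 2 := by gcongr
    _ = _ := Real.sq_sqrt (by positivity)

theorem measurable_cauchyComp (s : Fin (m + 1)) : Measurable (cauchyComp s) := by
  unfold cauchyComp
  fun_prop

theorem cauchyComp_neg (s : Fin (m + 1)) (y : Fin (m + 1) → ℝ) :
    cauchyComp s (-y) = -cauchyComp s y := by
  simp [cauchyComp]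

theorem norm_cauchyComp_le (s : Fin (m + 1)) {y : Fin (m + 1) → ℝ} (hy : y ≠ 0) :
    ‖cauchyComp s y‖ ≤ (usigma (m + 1))⁻¹ * ‖y‖ ^ (-(m : ℝ)) := by
  have hpos : 0 < ‖y‖ := norm_pos_iff.2 hy
  have hσ := usigma_pos (Nat.succ_pos m)
  rw [cauchyComp, norm_mul, norm_mul, Real.norm_of_nonneg (inv_nonneg.2 hσ.le)]
  gcongr
  calc ‖y s‖ * ‖(∑ i, y i ^ 2) ^ (-((m + 1 : ℕ) : ℝ) / 2)‖
      ≤ ‖y‖ * (‖y‖ ^ 2) ^ (-((m + 1 : ℕ) : ℝ) / 2) := by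
        rw [Real.norm_of_nonneg (Real.rpow_nonneg (sum_sq_pos hy).le _)]
        refine mul_le_mul (norm_le_pi_norm y s) (Real.rpow_le_rpow_of_nonpos (by positivity)
          (norm_sq_le_sum_sq y) ?_) (Real.rpow_nonneg (sum_sq_pos hy).le _) (norm_nonneg _)
        have : (0 : ℝ) ≤ ((m + 1 : ℕ) : ℝ) := by positivity
        linarith
    _ = ‖y‖ ^ (-(m : ℝ)) := by
        rw [← Real.rpow_natCast ‖y‖ 2, ← Real.rpow_mul hpos.le]
        nth_rewrite 1 [← Real.rpow_one ‖y‖]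
        rw [← Real.rpow_add hpos]
        congr 1
        push_cast
        ring

theorem locallyIntegrable_cauchyComp (s : Fin (m + 1)) :
    LocallyIntegrable (cauchyComp s) := by
  refine locallyIntegrable_of_norm_le_rpow (C := (usigma (m + 1))⁻¹) (α := m) (by simp) (by simp)
    ?_ (measurable_cauchyComp s).aestronglyMeasurable
  filter_upwards [compl_mem_ae_iff.2 (measure_singleton (0 : Fin (m + 1) → ℝ))] with y hy
  exact norm_cauchyComp_le s hy

theorem continuous_cauchyCompReg {ε : ℝ} (hε : ε ≠ 0) (s : Fin (m + 1)) :
    Continuous (cauchyCompReg ε s) := by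
  unfold cauchyCompReg
  refine continuous_const.mul ((continuous_apply s).mul ?_)
  refine Continuous.rpow_const (by fun_prop) fun y => Or.inl ?_
  have : 0 ≤ ∑ i, y i ^ 2 := by positivity
  positivity

theorem norm_cauchyCompReg_le (ε : ℝ) (s : Fin (m + 1)) {y : Fin (m + 1) → ℝ} (hy : y ≠ 0) :
    ‖cauchyCompReg ε s y‖ ≤ ‖cauchyComp s y‖ := by
  have hq := sum_sq_pos hy
  have hσ := usigma_pos (Nat.succ_pos m)
  rw [cauchyComp, cauchyCompReg, norm_mul, norm_mul, norm_mul, norm_mul,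
    Real.norm_of_nonneg (Real.rpow_nonneg hq.le _),
    Real.norm_of_nonneg (Real.rpow_nonneg (by positivity) _)]
  gcongr ?_ * (?_ * ?_)
  refine Real.rpow_le_rpow_of_nonpos hq (by nlinarith [sq_nonneg ε]) ?_
  have : (0 : ℝ) ≤ ((m + 1 : ℕ) : ℝ) := by positivity
  linarith

theorem tendsto_cauchyCompReg (s : Fin (m + 1)) {y : Fin (m + 1) → ℝ} (hy : y ≠ 0) :
    Filter.Tendsto (fun ε => cauchyCompReg ε s y) (nhdsWithin 0 (Set.Ioi 0))
      (nhds (cauchyComp s y)) := by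
  refine Filter.Tendsto.mono_left ?_ nhdsWithin_le_nhds
  have hc : ContinuousAt (fun ε => cauchyCompReg ε s y) 0 := by
    unfold cauchyCompReg
    refine continuousAt_const.mul (continuousAt_const.mul ?_)
    refine ContinuousAt.rpow_const (by fun_prop) (Or.inl ?_)
    have := sum_sq_pos hy
    positivity
  simpa [ContinuousAt, cauchyCompReg, cauchyComp] using hc

/-- The partial derivative of `cauchyCompReg ε t` in the direction `s`. -/
def cauchyCompRegDeriv (ε : ℝ) (t s : Fin (m + 1)) (y : Fin (m + 1) → ℝ) : ℝ :=
  (usigma (m + 1))⁻¹ * ((if t = s then 1 else 0) *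
      (∑ i, y i ^ 2 + ε ^ 2) ^ (-((m + 1 : ℕ) : ℝ) / 2) -
    ((m + 1 : ℕ) : ℝ) * (y t * y s) * (∑ i, y i ^ 2 + ε ^ 2) ^ (-((m + 1 : ℕ) : ℝ) / 2 - 1))

theorem continuous_cauchyCompRegDeriv {ε : ℝ} (hε : ε ≠ 0) (t s : Fin (m + 1)) :
    Continuous (cauchyCompRegDeriv ε t s) := by
  have h : ∀ a : ℝ, Continuous fun y : Fin (m + 1) → ℝ => (∑ i, y i ^ 2 + ε ^ 2) ^ a := fun a => by
    refine Continuous.rpow_const (by fun_prop) fun y => Or.inl ?_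
    have : 0 ≤ ∑ i, y i ^ 2 := by positivity
    positivity
  have h1 := h (-((m + 1 : ℕ) : ℝ) / 2)
  have h2 := h (-((m + 1 : ℕ) : ℝ) / 2 - 1)
  unfold cauchyCompRegDeriv
  fun_prop

theorem hasLineDerivAt_cauchyCompReg {ε : ℝ} (hε : ε ≠ 0) (t s : Fin (m + 1))
    (y : Fin (m + 1) → ℝ) :
    HasLineDerivAt ℝ (cauchyCompReg ε t) (cauchyCompRegDeriv ε t s y) y (Pi.single s 1) := by
  have hcoord : ∀ i, HasDerivAt (fun τ : ℝ => (y + τ • (Pi.single s (1 : ℝ) : Fin (m + 1) → ℝ)) i)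
      (if i = s then 1 else 0) 0 := fun i => by
    have : HasDerivAt (fun τ : ℝ => y i + τ * (Pi.single s (1 : ℝ) : Fin (m + 1) → ℝ) i)
        (1 * (Pi.single s (1 : ℝ) : Fin (m + 1) → ℝ) i) 0 :=
      ((hasDerivAt_id (0 : ℝ)).mul_const _).const_add _
    simpa [Pi.single_apply] using this
  have hq : HasDerivAt
      (fun τ : ℝ => ∑ i, (y + τ • (Pi.single s (1 : ℝ) : Fin (m + 1) → ℝ)) i ^ 2 + ε ^ 2)
      (2 * y s) 0 := by
    have := (HasDerivAt.fun_sum (u := Finset.univ) fun i _ => (hcoord i).pow 2).add_const (ε ^ 2)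
    refine this.congr_deriv ?_
    simp
  have h0 : 0 ≤ ∑ i, y i ^ 2 := by positivity
  have := ((hcoord t).mul (hq.rpow_const (p := -((m + 1 : ℕ) : ℝ) / 2)
    (Or.inl (by simp only [zero_smul, add_zero]; positivity)))).const_mul (usigma (m + 1))⁻¹
  refine this.congr_deriv ?_
  simp only [zero_smul, add_zero, cauchyCompRegDeriv]
  ring

theorem cauchyCompRegDeriv_comm (ε : ℝ) (t s : Fin (m + 1)) (y : Fin (m + 1) → ℝ) :
    cauchyCompRegDeriv ε t s y = cauchyCompRegDeriv ε s t y := by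
  simp only [cauchyCompRegDeriv, eq_comm (a := t), mul_comm (y t)]

theorem sum_cauchyCompRegDeriv {ε : ℝ} (hε : ε ≠ 0) (y : Fin (m + 1) → ℝ) :
    ∑ s, cauchyCompRegDeriv ε s s y = (usigma (m + 1))⁻¹ * (((m + 1 : ℕ) : ℝ) * ε ^ 2 *
      (∑ i, y i ^ 2 + ε ^ 2) ^ (-((m + 1 : ℕ) : ℝ) / 2 - 1)) := by
  have h0 : 0 ≤ ∑ i, y i ^ 2 := by positivity
  have hq : 0 < ∑ i, y i ^ 2 + ε ^ 2 := by positivity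
  simp only [cauchyCompRegDeriv, if_true, ← Finset.mul_sum, Finset.sum_sub_distrib,
    ← Finset.sum_mul, ← pow_two]
  rw [Real.rpow_sub_one hq.ne']
  simp only [Finset.sum_const, Finset.card_univ, Fintype.card_fin, nsmul_eq_mul]
  field_simp
  ring

theorem integrable_one_add_sum_sq_rpow :
    Integrable fun y : Fin (m + 1) → ℝ =>
      ((m + 1 : ℕ) : ℝ) * (∑ i, y i ^ 2 + 1) ^ (-((m + 1 : ℕ) : ℝ) / 2 - 1) := by
  have h := integrable_rpow_neg_one_add_norm_sq
    (μ := (volume : Measure (EuclideanSpace ℝ (Fin (m + 1))))) (r := (m + 3 : ℕ))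
    (by rw [finrank_euclideanSpace_fin]; norm_cast; omega)
  rw [← (PiLp.volume_preserving_toLp (Fin (m + 1))).integrable_comp_emb
    (MeasurableEquiv.toLp 2 _).measurableEmbedding] at h
  refine (h.const_mul ((m + 1 : ℕ) : ℝ)).congr (Filter.Eventually.of_forall fun y => ?_)
  simp only [Function.comp_apply, EuclideanSpace.real_norm_sq_eq, add_comm (1 : ℝ)]
  congr 2
  push_cast
  ring

theorem integral_Ioi_one_add_sq_rpow :
    ∫ r in Set.Ioi (0 : ℝ), r ^ m • (((m + 1 : ℕ) : ℝ) * (r ^ 2 + 1) ^ (-((m + 1 : ℕ) : ℝ) / 2 - 1))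
      = 1 := by
  have hd : ∀ r ∈ Set.Ici (0 : ℝ), HasDerivAt
      (fun r : ℝ => r ^ (m + 1) * (r ^ 2 + 1) ^ (-((m + 1 : ℕ) : ℝ) / 2))
      (r ^ m • (((m + 1 : ℕ) : ℝ) * (r ^ 2 + 1) ^ (-((m + 1 : ℕ) : ℝ) / 2 - 1))) r := by
    intro r _
    have hq : 0 < r ^ 2 + 1 := by positivity
    have := (hasDerivAt_pow (m + 1) r).mul
      ((((hasDerivAt_pow 2 r).add_const 1).rpow_const (p := -((m + 1 : ℕ) : ℝ) / 2)
        (Or.inl hq.ne')))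
    refine this.congr_deriv ?_
    rw [Real.rpow_sub_one hq.ne']
    simp only [Nat.add_sub_cancel, smul_eq_mul]
    field_simp
    ring
  have hlim : Filter.Tendsto (fun r : ℝ => r ^ (m + 1) * (r ^ 2 + 1) ^ (-((m + 1 : ℕ) : ℝ) / 2))
      Filter.atTop (nhds 1) := by
    have h1 : Filter.Tendsto (fun r : ℝ => (1 + (r ^ 2)⁻¹) ^ (-((m + 1 : ℕ) : ℝ) / 2))
        Filter.atTop (nhds ((1 + 0) ^ (-((m + 1 : ℕ) : ℝ) / 2))) :=
      ((tendsto_inv_atTop_zero.comp (Filter.tendsto_pow_atTop two_ne_zero)).const_add 1).rpow_const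
        (Or.inl (by norm_num))
    rw [add_zero, Real.one_rpow] at h1
    refine h1.congr' ?_
    filter_upwards [Filter.eventually_gt_atTop 0] with r hr
    have : r ^ 2 + 1 = r ^ 2 * (1 + (r ^ 2)⁻¹) := by field_simp
    rw [this, Real.mul_rpow (by positivity) (by positivity), ← mul_assoc, ← Real.rpow_natCast r 2,
      ← Real.rpow_mul hr.le, ← Real.rpow_natCast r (m + 1), ← Real.rpow_add hr]
    have : ((m + 1 : ℕ) : ℝ) + ((2 : ℕ) : ℝ) * (-((m + 1 : ℕ) : ℝ) / 2) = 0 := by push_cast; ring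
    rw [this, Real.rpow_zero, one_mul]
  rw [integral_Ioi_of_hasDerivAt_of_nonneg' hd (fun r hr => ?_) hlim]
  · simp
  · have : 0 < r := hr
    positivity

theorem integral_one_add_sum_sq_rpow :
    ∫ y : Fin (m + 1) → ℝ,
      ((m + 1 : ℕ) : ℝ) * (∑ i, y i ^ 2 + 1) ^ (-((m + 1 : ℕ) : ℝ) / 2 - 1) = usigma (m + 1) := by
  have h := integral_fun_norm_addHaar (volume : Measure (EuclideanSpace ℝ (Fin (m + 1))))
    fun r : ℝ => ((m + 1 : ℕ) : ℝ) * (r ^ 2 + 1) ^ (-((m + 1 : ℕ) : ℝ) / 2 - 1)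
  rw [finrank_euclideanSpace_fin, Nat.add_sub_cancel, integral_Ioi_one_add_sq_rpow] at h
  rw [← (PiLp.volume_preserving_toLp (Fin (m + 1))).integral_comp
    (MeasurableEquiv.toLp 2 _).measurableEmbedding] at h
  simp only [EuclideanSpace.real_norm_sq_eq] at h
  rw [h, Measure.real, EuclideanSpace.volume_ball, usigma, Fintype.card_fin]
  have hN : (0 : ℝ) < ((m + 1 : ℕ) : ℝ) := by positivity
  have hG : 0 < Real.Gamma (((m + 1 : ℕ) : ℝ) / 2) := Real.Gamma_pos_of_pos (by positivity)
  rw [Real.Gamma_add_one (by positivity), ENNReal.ofReal_one, one_pow, one_mul,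
    ENNReal.toReal_ofReal (by positivity), Real.sqrt_eq_rpow, ← Real.rpow_natCast,
    ← Real.rpow_mul Real.pi_pos.le]
  simp only [nsmul_eq_mul, smul_eq_mul, mul_one]
  rw [show (1 / 2 * ((m + 1 : ℕ) : ℝ)) = ((m + 1 : ℕ) : ℝ) / 2 by ring]
  field_simp

section KernelIdentities

variable {E : Type} [NormedAddCommGroup E] [NormedSpace ℝ E] {h : (Fin (m + 1) → ℝ) → E}

theorem continuous_pd1 (hh : ContDiff ℝ 1 h) (s : Fin (m + 1)) : Continuous (pd1 h s) :=
  (hh.continuous_fderiv one_ne_zero).clm_apply continuous_const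

theorem hasCompactSupport_pd1 (hs : HasCompactSupport h) (s : Fin (m + 1)) :
    HasCompactSupport (pd1 h s) :=
  hs.fderiv_apply (𝕜 := ℝ) _

theorem integrable_cauchyComp_smul {u : (Fin (m + 1) → ℝ) → E} (s : Fin (m + 1))
    (hu : Continuous u) (hc : HasCompactSupport u) :
    Integrable fun y => cauchyComp s y • u y :=
  (locallyIntegrable_cauchyComp s).integrable_smul_right_of_hasCompactSupport hu hc

theorem integral_cauchyCompReg_smul_pd1 {ε : ℝ} (hε : ε ≠ 0) (hh : ContDiff ℝ 1 h)
    (hs : HasCompactSupport h) (t s : Fin (m + 1)) :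
    ∫ y, cauchyCompReg ε t y • pd1 h s y = -∫ y, cauchyCompRegDeriv ε t s y • h y := by
  refine integral_bilinear_hasLineDerivAt_right_eq_neg_left_of_integrable
    (v := Pi.single s 1) (B := ContinuousLinearMap.lsmul ℝ ℝ) ?_ ?_ ?_ ?_ ?_
  · exact ((continuous_cauchyCompRegDeriv hε t s).smul hh.continuous).integrable_of_hasCompactSupport
      hs.smul_left
  · exact ((continuous_cauchyCompReg hε t).smul (continuous_pd1 hh s)).integrable_of_hasCompactSupport
      (hasCompactSupport_pd1 hs s).smul_left
  · exact ((continuous_cauchyCompReg hε t).smul hh.continuous).integrable_of_hasCompactSupport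
      hs.smul_left
  · exact fun y _ => hasLineDerivAt_cauchyCompReg hε t s y
  · exact fun y _ => ((hh.differentiable one_ne_zero) y).hasFDerivAt.hasLineDerivAt _

theorem tendsto_integral_cauchyCompReg_smul {u : (Fin (m + 1) → ℝ) → E} (s : Fin (m + 1))
    (hu : Continuous u) (hc : HasCompactSupport u) :
    Filter.Tendsto (fun ε => ∫ y, cauchyCompReg ε s y • u y) (nhdsWithin 0 (Set.Ioi 0))
      (nhds (∫ y, cauchyComp s y • u y)) := by
  have h0 : ∀ᵐ y : Fin (m + 1) → ℝ, y ≠ 0 := compl_mem_ae_iff.2 (measure_singleton _)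
  refine tendsto_integral_filter_of_dominated_convergence (fun y => ‖cauchyComp s y • u y‖)
    ?_ ?_ (integrable_cauchyComp_smul s hu hc).norm ?_
  · filter_upwards [self_mem_nhdsWithin] with ε hε
    exact ((continuous_cauchyCompReg (ne_of_gt hε) s).smul hu).aestronglyMeasurable
  · filter_upwards with ε
    filter_upwards [h0] with y hy
    rw [norm_smul, norm_smul]
    gcongr
    exact norm_cauchyCompReg_le ε s hy
  · filter_upwards [h0] with y hy
    exact (tendsto_cauchyCompReg s hy).smul_const _

theorem integral_cauchyComp_smul_pd1_comm (hh : ContDiff ℝ 1 h)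
    (hs : HasCompactSupport h) (t s : Fin (m + 1)) :
    ∫ y, cauchyComp t y • pd1 h s y = ∫ y, cauchyComp s y • pd1 h t y := by
  refine tendsto_nhds_unique (tendsto_integral_cauchyCompReg_smul t (continuous_pd1 hh s)
    (hasCompactSupport_pd1 hs s)) ((tendsto_integral_cauchyCompReg_smul s (continuous_pd1 hh t)
    (hasCompactSupport_pd1 hs t)).congr' ?_)
  filter_upwards [self_mem_nhdsWithin] with ε hε
  rw [integral_cauchyCompReg_smul_pd1 (ne_of_gt hε) hh hs,
    integral_cauchyCompReg_smul_pd1 (ne_of_gt hε) hh hs]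
  simp only [cauchyCompRegDeriv_comm ε t s]

theorem sum_integral_cauchyCompReg_smul_pd1 {ε : ℝ} (hε : 0 < ε) (hh : ContDiff ℝ 1 h)
    (hs : HasCompactSupport h) :
    ∑ s, ∫ y, cauchyCompReg ε s y • pd1 h s y =
      -∫ y, ((usigma (m + 1))⁻¹ * (((m + 1 : ℕ) : ℝ) *
        (∑ i, y i ^ 2 + 1) ^ (-((m + 1 : ℕ) : ℝ) / 2 - 1))) • h (ε • y) := by
  simp only [integral_cauchyCompReg_smul_pd1 hε.ne' hh hs, Finset.sum_neg_distrib]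
  have hint : ∀ s ∈ (Finset.univ : Finset (Fin (m + 1))),
      Integrable fun y => cauchyCompRegDeriv ε s s y • h y := fun s _ =>
    ((continuous_cauchyCompRegDeriv hε.ne' s s).smul
      hh.continuous).integrable_of_hasCompactSupport hs.smul_left
  rw [← integral_finsetSum _ hint]
  simp only [← Finset.sum_smul, sum_cauchyCompRegDeriv hε.ne']
  set F : (Fin (m + 1) → ℝ) → E := fun y => ((usigma (m + 1))⁻¹ * (((m + 1 : ℕ) : ℝ) * ε ^ 2 *
      (∑ i, y i ^ 2 + ε ^ 2) ^ (-((m + 1 : ℕ) : ℝ) / 2 - 1))) • h y with hF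
  have hscale := Measure.integral_comp_smul volume F ε
  rw [Module.finrank_fin_fun, abs_of_pos (by positivity), eq_inv_smul_iff₀ (by positivity),
    ← integral_smul] at hscale
  rw [← hscale]
  congr 2
  ext y
  simp only [hF, smul_smul]
  congr 1
  have h0 : 0 ≤ ∑ i, y i ^ 2 := by positivity
  have hsum : ∑ i, (ε • y) i ^ 2 + ε ^ 2 = ε ^ 2 * (∑ i, y i ^ 2 + 1) := by
    simp only [Pi.smul_apply, smul_eq_mul, mul_pow, ← Finset.mul_sum]
    ring
  have hpow : ε ^ (m + 1) * ε ^ 2 * (ε ^ 2) ^ (-((m + 1 : ℕ) : ℝ) / 2 - 1) = 1 := by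
    rw [← Real.rpow_natCast ε 2, ← Real.rpow_natCast ε (m + 1), ← Real.rpow_mul hε.le,
      ← Real.rpow_add hε, ← Real.rpow_add hε]
    convert Real.rpow_zero ε using 2
    push_cast
    ring
  rw [hsum, Real.mul_rpow (by positivity) (by positivity)]
  linear_combination ((usigma (m + 1))⁻¹ * (((m + 1 : ℕ) : ℝ) *
        (∑ i, y i ^ 2 + 1) ^ (-((m + 1 : ℕ) : ℝ) / 2 - 1))) * hpow

theorem sum_integral_cauchyComp_smul_pd1 [CompleteSpace E] (hh : ContDiff ℝ 1 h)
    (hs : HasCompactSupport h) :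
    ∑ s, ∫ y, cauchyComp s y • pd1 h s y = -h 0 := by
  refine tendsto_nhds_unique (tendsto_finsetSum _ fun s _ =>
    tendsto_integral_cauchyCompReg_smul s (continuous_pd1 hh s) (hasCompactSupport_pd1 hs s)) ?_
  obtain ⟨C, hC⟩ := hs.exists_bound_of_continuous hh.continuous
  have hint := (integrable_one_add_sum_sq_rpow (m := m)).const_mul (usigma (m + 1))⁻¹
  have hlim : Filter.Tendsto (fun ε : ℝ => -∫ y : Fin (m + 1) → ℝ, ((usigma (m + 1))⁻¹ * (((m + 1 : ℕ) : ℝ) *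
        (∑ i, y i ^ 2 + 1) ^ (-((m + 1 : ℕ) : ℝ) / 2 - 1))) • h (ε • y))
      (nhdsWithin 0 (Set.Ioi 0)) (nhds (-∫ y : Fin (m + 1) → ℝ, ((usigma (m + 1))⁻¹ * (((m + 1 : ℕ) : ℝ) *
        (∑ i, y i ^ 2 + 1) ^ (-((m + 1 : ℕ) : ℝ) / 2 - 1))) • h 0)) := by
    refine (tendsto_integral_filter_of_dominated_convergence _ ?_ ?_
      (hint.norm.mul_const C) ?_).neg
    · filter_upwards with ε
      exact hint.aestronglyMeasurable.smul
        (hh.continuous.comp (continuous_const_smul ε)).aestronglyMeasurable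
    · filter_upwards with ε
      filter_upwards with y
      rw [norm_smul]
      gcongr
      exact hC _
    · filter_upwards with y
      refine Filter.Tendsto.const_smul ?_ _
      have : Continuous fun ε : ℝ => h (ε • y) :=
        hh.continuous.comp (continuous_id.smul continuous_const)
      simpa using (this.tendsto 0).mono_left nhdsWithin_le_nhds
  rw [integral_smul_const, integral_const_mul, integral_one_add_sum_sq_rpow,
    inv_mul_cancel₀ (usigma_pos (Nat.succ_pos m)).ne', one_smul] at hlim
  refine hlim.congr' ?_
  filter_upwards [self_mem_nhdsWithin] with ε hε
  exact (sum_integral_cauchyCompReg_smul_pd1 hε hh hs).symm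

end KernelIdentities

/-! ### Alternativity identities for the hypercomplex basis -/

namespace HCAlg

variable (H : HCAlg 𝔸 m)

theorem mul_mul_add_mul_mul (a b c : 𝔸) :
    H.mul a (H.mul b c) + H.mul b (H.mul a c) = H.mul (H.mul a b + H.mul b a) c := by
  have h := H.alt_left (a + b) c
  simp only [map_add, LinearMap.add_apply, H.alt_left a c, H.alt_left b c] at h ⊢
  rw [← sub_eq_zero] at h ⊢
  rw [← h]
  abel

theorem conj_v_zero : H.conj (H.v 0) = H.v 0 := by
  rw [H.v_zero, H.conj_one]

theorem conj_v {s : Fin (m + 1)} (hs : s ≠ 0) : H.conj (H.v s) = -H.v s :=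
  eq_neg_of_add_eq_zero_right (H.v_trace s hs)

theorem mul_v_zero (a : 𝔸) : H.mul (H.v 0) a = a := by
  rw [H.v_zero, H.one_mul']

theorem mul_v_self {s : Fin (m + 1)} (hs : s ≠ 0) (a : 𝔸) :
    H.mul (H.v s) (H.mul (H.v s) a) = -a := by
  have h := H.v_norm s hs
  rw [H.conj_v hs, map_neg, neg_eq_iff_eq_neg] at h
  rw [H.alt_left, h, map_neg, LinearMap.neg_apply, H.one_mul']

theorem mul_v_anticomm {s t : Fin (m + 1)} (hs : s ≠ 0) (ht : t ≠ 0) (hst : s ≠ t) (a : 𝔸) :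
    H.mul (H.v s) (H.mul (H.v t) a) = -H.mul (H.v t) (H.mul (H.v s) a) := by
  rw [eq_neg_iff_add_eq_zero, H.mul_mul_add_mul_mul, H.v_anticomm s t hs ht hst]
  simp

theorem mul_v_conj_v_add (s t : Fin (m + 1)) (a : 𝔸) :
    H.mul (H.v s) (H.mul (H.conj (H.v t)) a) + H.mul (H.v t) (H.mul (H.conj (H.v s)) a) =
      if s = t then (2 : ℝ) • a else 0 := by
  by_cases hst : s = t
  · subst hst
    rw [if_pos rfl, two_smul]
    by_cases hs : s = 0
    · subst hs
      simp only [H.conj_v_zero, H.mul_v_zero]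
    · simp [H.conj_v hs, H.mul_v_self hs]
  · rw [if_neg hst]
    by_cases hs : s = 0
    · subst hs
      simp [H.conj_v_zero, H.mul_v_zero, H.conj_v (Ne.symm hst)]
    · by_cases ht : t = 0
      · subst ht
        simp [H.conj_v_zero, H.mul_v_zero, H.conj_v hs]
      · simp [H.conj_v hs, H.conj_v ht, H.mul_v_anticomm hs ht hst]

theorem mul_conj_v_v_add (s t : Fin (m + 1)) (a : 𝔸) :
    H.mul (H.conj (H.v t)) (H.mul (H.v s) a) + H.mul (H.conj (H.v s)) (H.mul (H.v t) a) =
      if s = t then (2 : ℝ) • a else 0 := by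
  rw [← H.mul_v_conj_v_add s t a]
  by_cases hs : s = 0
  · subst hs
    by_cases ht : t = 0
    · subst ht
      simp only [H.conj_v_zero]
    · simp [H.conj_v_zero, H.mul_v_zero, H.conj_v ht]
  · by_cases ht : t = 0
    · subst ht
      simp [H.conj_v_zero, H.mul_v_zero, H.conj_v hs]
    · simp [H.conj_v hs, H.conj_v ht, add_comm]

theorem sum_symm_eq {B : Fin (m + 1) → Fin (m + 1) → 𝔸} (hB : ∀ s t, B s t = B t s)
    {T : Fin (m + 1) → Fin (m + 1) → 𝔸 →ₗ[ℝ] 𝔸}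
    (hT : ∀ s t a, T s t a + T t s a = if s = t then (2 : ℝ) • a else 0) :
    ∑ s, ∑ t, T s t (B s t) = ∑ s, B s s := by
  have h : ∑ s, ∑ t, T s t (B s t) + ∑ s, ∑ t, T s t (B s t) = (2 : ℝ) • ∑ s, B s s := by
    nth_rewrite 2 [Finset.sum_comm]
    rw [← Finset.sum_add_distrib, Finset.smul_sum]
    refine Finset.sum_congr rfl fun s _ => ?_
    rw [← Finset.sum_add_distrib]
    have : ∀ t, T s t (B s t) + T t s (B t s) = if s = t then (2 : ℝ) • B s t else 0 :=
      fun t => by rw [hB t s, hT]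
    simp [this]
  rw [← two_smul ℝ] at h
  exact smul_right_injective 𝔸 (two_ne_zero (α := ℝ)) h

theorem sum_mul_v_sum_mul_conj_v {B : Fin (m + 1) → Fin (m + 1) → 𝔸}
    (hB : ∀ s t, B s t = B t s) :
    ∑ s, H.mul (H.v s) (∑ t, H.mul (H.conj (H.v t)) (B s t)) = ∑ s, B s s := by
  simp only [map_sum]
  exact sum_symm_eq (T := fun s t => (H.mul (H.v s)).comp (H.mul (H.conj (H.v t)))) hB
    H.mul_v_conj_v_add

theorem sum_mul_conj_v_sum_mul_v {B : Fin (m + 1) → Fin (m + 1) → 𝔸}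
    (hB : ∀ s t, B s t = B t s) :
    ∑ t, H.mul (H.conj (H.v t)) (∑ s, H.mul (H.v s) (B t s)) = ∑ s, B s s := by
  simp only [map_sum]
  exact sum_symm_eq (T := fun t s => (H.mul (H.conj (H.v t))).comp (H.mul (H.v s))) hB
    fun s t a => by rw [← H.mul_conj_v_v_add s t a, add_comm]; rfl

end HCAlg

/-! ### The Cauchy transform in one hypercomplex variable -/

/-- The Dirac operator `∑_s v_s ∂/∂x_s` for functions of one hypercomplex variable. -/
def dbarOne (H : HCAlg 𝔸 m) (u : (Fin (m + 1) → ℝ) → 𝔸) (x : Fin (m + 1) → ℝ) : 𝔸 :=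
  ∑ s, H.mul (H.v s) (pd1 u s x)

/-- The convolution of a function with the `s`-th component of the Cauchy kernel. -/
def cauchyConv {E : Type} [NormedAddCommGroup E] [NormedSpace ℝ E] (s : Fin (m + 1))
    (u : (Fin (m + 1) → ℝ) → E) : (Fin (m + 1) → ℝ) → E :=
  convolution (cauchyComp s) u (ContinuousLinearMap.lsmul ℝ ℝ) volume

/-- The Cauchy transform `u ↦ E ⋆ u`. -/
def cauchyTransform (H : HCAlg 𝔸 m) (u : (Fin (m + 1) → ℝ) → 𝔸) (x : Fin (m + 1) → ℝ) : 𝔸 :=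
  ∑ s, H.mul (H.conj (H.v s)) (cauchyConv s u x)

theorem hasCompactSupport_comp_sub_left {E : Type*} [Zero E] {u : (Fin (m + 1) → ℝ) → E}
    (hc : HasCompactSupport u) (x : Fin (m + 1) → ℝ) : HasCompactSupport fun y => u (x - y) :=
  hc.comp_homeomorph (Homeomorph.subLeft x)

section CauchyConv

variable {E : Type} [NormedAddCommGroup E] [NormedSpace ℝ E] {u : (Fin (m + 1) → ℝ) → E}

theorem cauchyConv_apply (s : Fin (m + 1)) (u : (Fin (m + 1) → ℝ) → E) (x : Fin (m + 1) → ℝ) :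
    cauchyConv s u x = ∫ y, cauchyComp s y • u (x - y) := rfl

theorem cauchyConv_pd1 (s t : Fin (m + 1)) (hu : ContDiff ℝ 1 u) (x : Fin (m + 1) → ℝ) :
    cauchyConv s (pd1 u t) x = -∫ y, cauchyComp s y • pd1 (fun z => u (x - z)) t y := by
  rw [cauchyConv_apply, ← integral_neg]
  congr 1
  ext y
  have hd : HasFDerivAt (fun z => u (x - z)) ((fderiv ℝ u (x - y)).comp
      (-ContinuousLinearMap.id ℝ (Fin (m + 1) → ℝ))) y :=
    ((hu.differentiable one_ne_zero) (x - y)).hasFDerivAt.comp y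
      ((hasFDerivAt_id y).const_sub x)
  simp [pd1, hd.fderiv]

theorem cauchyConv_pd1_comm (hu : ContDiff ℝ 1 u) (hc : HasCompactSupport u)
    (s t : Fin (m + 1)) (x : Fin (m + 1) → ℝ) :
    cauchyConv s (pd1 u t) x = cauchyConv t (pd1 u s) x := by
  rw [cauchyConv_pd1 s t hu, cauchyConv_pd1 t s hu, integral_cauchyComp_smul_pd1_comm
    (by fun_prop) (hasCompactSupport_comp_sub_left hc x)]

theorem sum_cauchyConv_pd1 [CompleteSpace E] (hu : ContDiff ℝ 1 u) (hc : HasCompactSupport u)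
    (x : Fin (m + 1) → ℝ) : ∑ s, cauchyConv s (pd1 u s) x = u x := by
  simp only [cauchyConv_pd1 _ _ hu, Finset.sum_neg_distrib]
  rw [sum_integral_cauchyComp_smul_pd1 (by fun_prop) (hasCompactSupport_comp_sub_left hc x)]
  simp

theorem hasFDerivAt_cauchyConv (hu : ContDiff ℝ 1 u) (hc : HasCompactSupport u)
    (s : Fin (m + 1)) (x : Fin (m + 1) → ℝ) :
    HasFDerivAt (cauchyConv s u) (convolution (cauchyComp s) (fderiv ℝ u)
      ((ContinuousLinearMap.lsmul ℝ ℝ).precompR (Fin (m + 1) → ℝ)) volume x) x :=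
  hc.hasFDerivAt_convolution_right _ (locallyIntegrable_cauchyComp s) hu x

theorem pd1_cauchyConv (hu : ContDiff ℝ 1 u) (hc : HasCompactSupport u)
    (s t : Fin (m + 1)) (x : Fin (m + 1) → ℝ) :
    pd1 (cauchyConv s u) t x = cauchyConv s (pd1 u t) x := by
  rw [pd1, (hasFDerivAt_cauchyConv hu hc s x).fderiv]
  exact convolution_precompR_apply _ (locallyIntegrable_cauchyComp s) (hc.fderiv ℝ)
    (hu.continuous_fderiv one_ne_zero) x _

end CauchyConv

theorem dbarOne_cauchyTransform (H : HCAlg 𝔸 m) {u : (Fin (m + 1) → ℝ) → 𝔸}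
    (hu : ContDiff ℝ 1 u) (hc : HasCompactSupport u) (x : Fin (m + 1) → ℝ) :
    dbarOne H (cauchyTransform H u) x = u x := by
  have := H.findim
  have := FiniteDimensional.complete ℝ 𝔸
  have hpd : ∀ s, pd1 (cauchyTransform H u) s x =
      ∑ t, H.mul (H.conj (H.v t)) (cauchyConv t (pd1 u s) x) := fun s => by
    have hd : HasFDerivAt (cauchyTransform H u) _ x := HasFDerivAt.fun_sum
      (u := Finset.univ) fun t _ => (H.mul (H.conj (H.v t))).toContinuousLinearMap.hasFDerivAt.comp x
        (hasFDerivAt_cauchyConv hu hc t x)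
    rw [pd1, hd.fderiv, sum_apply]
    refine Finset.sum_congr rfl fun t _ => ?_
    rw [← pd1_cauchyConv hu hc t s x, pd1, (hasFDerivAt_cauchyConv hu hc t x).fderiv]
    rfl
  simp only [dbarOne, hpd]
  rw [H.sum_mul_v_sum_mul_conj_v (B := fun s t => cauchyConv t (pd1 u s) x)
    fun s t => cauchyConv_pd1_comm hu hc t s x]
  exact sum_cauchyConv_pd1 hu hc x

theorem cauchyTransform_dbarOne (H : HCAlg 𝔸 m) {u : (Fin (m + 1) → ℝ) → 𝔸}
    (hu : ContDiff ℝ 1 u) (hc : HasCompactSupport u) (x : Fin (m + 1) → ℝ) :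
    cauchyTransform H (dbarOne H u) x = u x := by
  have := H.findim
  have := FiniteDimensional.complete ℝ 𝔸
  have hint : ∀ t s, Integrable fun y => cauchyComp t y • pd1 u s (x - y) := fun t s =>
    integrable_cauchyComp_smul t ((continuous_pd1 hu s).comp (by fun_prop))
      (hasCompactSupport_comp_sub_left (hasCompactSupport_pd1 hc s) x)
  have hconv : ∀ t, cauchyConv t (dbarOne H u) x =
      ∑ s, H.mul (H.v s) (cauchyConv t (pd1 u s) x) := fun t => by
    have h1 : ∀ s, H.mul (H.v s) (cauchyConv t (pd1 u s) x) =
        ∫ y, H.mul (H.v s) (cauchyComp t y • pd1 u s (x - y)) := fun s =>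
      ((H.mul (H.v s)).toContinuousLinearMap.integral_comp_comm (hint t s)).symm
    simp only [h1]
    have h2 : ∀ s ∈ (Finset.univ : Finset (Fin (m + 1))),
        Integrable fun y => H.mul (H.v s) (cauchyComp t y • pd1 u s (x - y)) := fun s _ =>
      (H.mul (H.v s)).toContinuousLinearMap.integrable_comp (hint t s)
    rw [← integral_finsetSum _ h2, cauchyConv_apply]
    simp only [dbarOne, Finset.smul_sum, map_smul]
  simp only [cauchyTransform, hconv]
  rw [H.sum_mul_conj_v_sum_mul_v (B := fun t s => cauchyConv t (pd1 u s) x)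
    fun s t => cauchyConv_pd1_comm hu hc s t x]
  exact sum_cauchyConv_pd1 hu hc x

/-! ### Analyticity along segments and unique continuation -/

section LineExtension

variable (p w : Fin (m + 1) → ℝ)

/-- The complexification of `t ↦ |p + t w - y|²`. -/
def lineSq (z : ℂ × (Fin (m + 1) → ℝ)) : ℂ := ∑ i, ((p i : ℂ) + z.1 * w i - z.2 i) ^ 2

/-- The complexification of `t ↦ cauchyComp s (p + t w - y)`. -/
def lineCauchyComp (s : Fin (m + 1)) (z : ℂ × (Fin (m + 1) → ℝ)) : ℂ :=
  ((usigma (m + 1))⁻¹ : ℝ) * (((p s : ℂ) + z.1 * w s - z.2 s) *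
    lineSq p w z ^ ((-((m + 1 : ℕ) : ℝ) / 2 : ℝ) : ℂ))

/-- The complex derivative of `lineCauchyComp` in its first variable. -/
def lineCauchyCompDeriv (s : Fin (m + 1)) (z : ℂ × (Fin (m + 1) → ℝ)) : ℂ :=
  ((usigma (m + 1))⁻¹ : ℝ) * (w s * lineSq p w z ^ ((-((m + 1 : ℕ) : ℝ) / 2 : ℝ) : ℂ) +
    ((p s : ℂ) + z.1 * w s - z.2 s) * (((-((m + 1 : ℕ) : ℝ) / 2 : ℝ) : ℂ) *
      lineSq p w z ^ (((-((m + 1 : ℕ) : ℝ) / 2 : ℝ) : ℂ) - 1) *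
      ∑ i, 2 * ((p i : ℂ) + z.1 * w i - z.2 i) * w i))

theorem continuous_lineSq : Continuous (lineSq p w) := by
  unfold lineSq
  fun_prop

theorem continuousOn_lineCauchyComp (s : Fin (m + 1)) :
    ContinuousOn (lineCauchyComp p w s) {z | 0 < (lineSq p w z).re} := by
  have h : ContinuousOn (fun z => lineSq p w z ^ ((-((m + 1 : ℕ) : ℝ) / 2 : ℝ) : ℂ))
      {z | 0 < (lineSq p w z).re} :=
    (continuous_lineSq p w).continuousOn.cpow continuousOn_const fun z hz => Or.inl hz
  unfold lineCauchyComp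
  fun_prop

theorem continuousOn_lineCauchyCompDeriv (s : Fin (m + 1)) :
    ContinuousOn (lineCauchyCompDeriv p w s) {z | 0 < (lineSq p w z).re} := by
  have h : ∀ a : ℂ, ContinuousOn (fun z => lineSq p w z ^ a) {z | 0 < (lineSq p w z).re} :=
    fun a => (continuous_lineSq p w).continuousOn.cpow continuousOn_const fun z hz => Or.inl hz
  have h1 := h ((-((m + 1 : ℕ) : ℝ) / 2 : ℝ) : ℂ)
  have h2 := h (((-((m + 1 : ℕ) : ℝ) / 2 : ℝ) : ℂ) - 1)
  unfold lineCauchyCompDeriv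
  fun_prop

theorem hasDerivAt_lineCauchyComp (s : Fin (m + 1)) {t : ℂ} {y : Fin (m + 1) → ℝ}
    (h : 0 < (lineSq p w (t, y)).re) :
    HasDerivAt (fun t => lineCauchyComp p w s (t, y)) (lineCauchyCompDeriv p w s (t, y)) t := by
  have hcoord : ∀ i, HasDerivAt (fun t : ℂ => (p i : ℂ) + t * w i - y i) (w i) t := fun i => by
    simpa using (((hasDerivAt_id t).mul_const (w i : ℂ)).const_add (p i : ℂ)).sub_const (y i : ℂ)
  have hq : HasDerivAt (fun t => lineSq p w (t, y))
      (∑ i, 2 * ((p i : ℂ) + t * w i - y i) * w i) t := by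
    have := HasDerivAt.fun_sum (u := Finset.univ) fun i _ => (hcoord i).pow 2
    refine this.congr_deriv ?_
    simp
  exact ((hcoord s).mul (hq.cpow_const (Or.inl h))).const_mul _

theorem lineCauchyComp_ofReal (s : Fin (m + 1)) (t : ℝ) (y : Fin (m + 1) → ℝ) :
    lineCauchyComp p w s ((t : ℂ), y) = (cauchyComp s (p + t • w - y) : ℝ) := by
  have h0 : 0 ≤ ∑ i, (p + t • w - y) i ^ 2 := by positivity
  have hq : lineSq p w ((t : ℂ), y) = (∑ i, (p + t • w - y) i ^ 2 : ℝ) := by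
    simp [lineSq]
  rw [lineCauchyComp, cauchyComp, hq, ← Complex.ofReal_cpow h0]
  simp

variable {p w}

theorem differentiableAt_integral_lineCauchyComp (s : Fin (m + 1))
    {c : (Fin (m + 1) → ℝ) → ℝ} (hc : Continuous c) {K : Set (Fin (m + 1) → ℝ)} (hK : IsCompact K)
    {t₀ : ℂ} (ht₀ : ∀ y ∈ K, 0 < (lineSq p w (t₀, y)).re) :
    DifferentiableAt ℂ (fun t => ∫ y in K, lineCauchyComp p w s (t, y) * c y) t₀ := by
  have hev : ∀ᶠ t in nhds t₀, ∀ y ∈ K, 0 < (lineSq p w (t, y)).re :=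
    hK.eventually_forall_of_forall_eventually fun y hy =>
      (Complex.continuous_re.comp (continuous_lineSq p w)).continuousAt.eventually
        (lt_mem_nhds (ht₀ y hy))
  obtain ⟨r, hr, hball⟩ := Metric.nhds_basis_closedBall.mem_iff.1 hev
  have hsub : ∀ t ∈ Metric.closedBall t₀ r, ∀ y ∈ K, 0 < (lineSq p w (t, y)).re :=
    fun t ht => hball ht
  have hcont : ∀ t ∈ Metric.closedBall t₀ r,
      ContinuousOn (fun y => lineCauchyComp p w s (t, y) * c y) K := fun t ht =>
    ((continuousOn_lineCauchyComp p w s).comp (by fun_prop) (hsub t ht)).mul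
      (Complex.continuous_ofReal.comp hc).continuousOn
  have hcont' : ContinuousOn (fun z : ℂ × (Fin (m + 1) → ℝ) => lineCauchyCompDeriv p w s z * c z.2)
      (Metric.closedBall t₀ r ×ˢ K) :=
    ((continuousOn_lineCauchyCompDeriv p w s).mono fun z hz => hsub z.1 hz.1 z.2 hz.2).mul
      (Complex.continuous_ofReal.comp (hc.comp continuous_snd)).continuousOn
  obtain ⟨C, hC⟩ := ((isCompact_closedBall t₀ r).prod hK).exists_bound_of_continuousOn hcont'
  have hmem : t₀ ∈ Metric.closedBall t₀ r := Metric.mem_closedBall_self hr.le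
  refine (hasDerivAt_integral_of_dominated_loc_of_deriv_le
    (F' := fun t y => lineCauchyCompDeriv p w s (t, y) * c y) (bound := fun _ => C)
    (Metric.closedBall_mem_nhds t₀ hr) ?_ ((hcont t₀ hmem).integrableOn_compact hK) ?_ ?_
    (integrableOn_const hK.measure_lt_top.ne) ?_).2.differentiableAt
  · filter_upwards [Metric.closedBall_mem_nhds t₀ hr] with t ht
    exact (hcont t ht).aestronglyMeasurable hK.measurableSet
  · exact (hcont'.comp (f := fun y => (t₀, y)) (by fun_prop) fun y hy =>
      ⟨hmem, hy⟩).aestronglyMeasurable hK.measurableSet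
  · filter_upwards [ae_restrict_mem hK.measurableSet] with y hy t ht
    exact hC (t, y) ⟨ht, hy⟩
  · filter_upwards [ae_restrict_mem hK.measurableSet] with y hy t ht
    exact (hasDerivAt_lineCauchyComp p w s (hsub t ht y hy)).mul_const _

/-- The convolution of a component of the Cauchy kernel with a function is real analytic along
segments which avoid the support of that function. -/
theorem analyticOnNhd_cauchyConv_segment (s : Fin (m + 1)) {c : (Fin (m + 1) → ℝ) → ℝ}
    (hc : Continuous c) (hcs : HasCompactSupport c)
    (hpw : ∀ t ∈ Set.Icc (0 : ℝ) 1, p + t • w ∉ tsupport c) :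
    AnalyticOnNhd ℝ (fun t : ℝ => cauchyConv s c (p + t • w)) (Set.Icc 0 1) := by
  set ψ : ℂ → ℂ := fun t => ∫ y in tsupport c, lineCauchyComp p w s (t, y) * c y with hψ
  have hre : (fun t : ℝ => cauchyConv s c (p + t • w)) = fun t : ℝ => (ψ t).re := by
    ext t
    have h1 : ψ t = ∫ y in tsupport c, ((cauchyComp s (p + t • w - y) * c y : ℝ) : ℂ) := by
      simp only [hψ, lineCauchyComp_ofReal, Complex.ofReal_mul]
    have h2 : ∀ y ∉ tsupport c, cauchyComp s (p + t • w - y) * c y = 0 := fun y hy => by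
      rw [image_eq_zero_of_notMem_tsupport hy, mul_zero]
    rw [h1, integral_complex_ofReal, Complex.ofReal_re, setIntegral_eq_integral_of_forall_compl_eq_zero h2,
      cauchyConv, convolution_eq_swap]
    rfl
  have hopen : IsOpen {t : ℂ | ∀ y ∈ tsupport c, 0 < (lineSq p w (t, y)).re} :=
    isOpen_iff_mem_nhds.2 fun t ht => hcs.isCompact.eventually_forall_of_forall_eventually
      fun y hy => (Complex.continuous_re.comp (continuous_lineSq p w)).continuousAt.eventually
        (lt_mem_nhds (ht y hy))
  have hdiff : DifferentiableOn ℂ ψ {t : ℂ | ∀ y ∈ tsupport c, 0 < (lineSq p w (t, y)).re} :=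
    fun t ht =>
      (differentiableAt_integral_lineCauchyComp s hc hcs.isCompact ht).differentiableWithinAt
  intro t ht
  rw [hre]
  have hmem : (t : ℂ) ∈ {t : ℂ | ∀ y ∈ tsupport c, 0 < (lineSq p w (t, y)).re} := fun y hy => by
    have hne : p + t • w - y ≠ 0 := sub_ne_zero.2 fun h => hpw t ht (h ▸ hy)
    have hq : lineSq p w ((t : ℂ), y) = (∑ i, (p + t • w - y) i ^ 2 : ℝ) := by
      simp [lineSq]
    rw [hq, Complex.ofReal_re]
    exact sum_sq_pos hne
  exact ((hdiff.analyticAt (hopen.mem_nhds hmem))).re_ofReal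

end LineExtension

theorem continuous_dbarOne (H : HCAlg 𝔸 m) {u : (Fin (m + 1) → ℝ) → 𝔸} (hu : ContDiff ℝ 1 u) :
    Continuous (dbarOne H u) := by
  have := H.findim
  exact continuous_finsetSum _ fun s _ =>
    (H.mul (H.v s)).continuous_of_finiteDimensional.comp (continuous_pd1 hu s)

theorem hasCompactSupport_dbarOne (H : HCAlg 𝔸 m) {u : (Fin (m + 1) → ℝ) → 𝔸}
    (hc : HasCompactSupport u) : HasCompactSupport (dbarOne H u) := by
  refine (hc.fderiv ℝ).mono fun x hx => ?_
  contrapose! hx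
  simp only [Function.mem_support, not_not] at hx ⊢
  simp [dbarOne, pd1, hx]

theorem dbarOne_congr (H : HCAlg 𝔸 m) {u v : (Fin (m + 1) → ℝ) → 𝔸} {x : Fin (m + 1) → ℝ}
    (h : u =ᶠ[nhds x] v) : dbarOne H u x = dbarOne H v x := by
  simp only [dbarOne, pd1, h.fderiv_eq]

theorem apply_cauchyTransform (H : HCAlg 𝔸 m) {h : (Fin (m + 1) → ℝ) → 𝔸} (hh : Continuous h)
    (hc : HasCompactSupport h) (l : 𝔸 →ₗ[ℝ] ℝ) (x : Fin (m + 1) → ℝ) :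
    l (cauchyTransform H h x) =
      ∑ s, cauchyConv s (fun y => l (H.mul (H.conj (H.v s)) (h y))) x := by
  have := H.findim
  have := FiniteDimensional.complete ℝ 𝔸
  rw [cauchyTransform, map_sum]
  refine Finset.sum_congr rfl fun s _ => ?_
  have hint : Integrable fun y => cauchyComp s y • h (x - y) :=
    integrable_cauchyComp_smul s (by fun_prop) (hasCompactSupport_comp_sub_left hc x)
  have := ((l.comp (H.mul (H.conj (H.v s)))).toContinuousLinearMap.integral_comp_comm hint).symm
  refine this.trans ?_
  simp [cauchyConv_apply]

/-- The components of a Cauchy transform are real analytic along segments contained in an open set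
on which the transformed function vanishes. -/
theorem analyticOnNhd_apply_cauchyTransform_segment (H : HCAlg 𝔸 m)
    {h : (Fin (m + 1) → ℝ) → 𝔸} (hh : Continuous h) (hc : HasCompactSupport h)
    {V : Set (Fin (m + 1) → ℝ)} (hV : IsOpen V) (h0 : ∀ x ∈ V, h x = 0)
    {p w : Fin (m + 1) → ℝ} (hpw : ∀ t ∈ Set.Icc (0 : ℝ) 1, p + t • w ∈ V) (l : 𝔸 →ₗ[ℝ] ℝ) :
    AnalyticOnNhd ℝ (fun t : ℝ => l (cauchyTransform H h (p + t • w))) (Set.Icc 0 1) := by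
  have := H.findim
  simp only [apply_cauchyTransform H hh hc]
  refine Finset.analyticOnNhd_fun_sum _ fun s _ => ?_
  let T : 𝔸 →ₗ[ℝ] ℝ := l.comp (H.mul (H.conj (H.v s)))
  have hTc : Continuous fun y => T (h y) := T.continuous_of_finiteDimensional.comp hh
  have hTs : HasCompactSupport fun y => T (h y) := hc.comp_left (map_zero T)
  refine analyticOnNhd_cauchyConv_segment s hTc hTs fun t ht hmem => ?_
  have hsub : Function.support (fun y => T (h y)) ⊆ Vᶜ := fun y hy hyV =>
    hy (by simp only [h0 y hyV, map_zero])
  exact closure_minimal hsub hV.isClosed_compl hmem (hpw t ht)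

/-- Unique continuation on balls for solutions of `∂̄ u = 0`. -/
theorem eq_zero_of_dbarOne_eq_zero (H : HCAlg 𝔸 m) {u : (Fin (m + 1) → ℝ) → 𝔸}
    (hu : ContDiff ℝ 1 u) {p q z : Fin (m + 1) → ℝ} {r : ℝ}
    (hd : ∀ x ∈ Metric.ball q r, dbarOne H u x = 0) (hp : p ∈ Metric.ball q r)
    (h0 : u =ᶠ[nhds p] 0) (hz : z ∈ Metric.ball q r) : u z = 0 := by
  have := H.findim
  obtain ⟨r₁, hr₁, hr₁r⟩ := exists_between (max_lt (Metric.mem_ball.1 hp) (Metric.mem_ball.1 hz))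
  have hr₁pos : 0 < r₁ := (dist_nonneg.trans (le_max_left _ _)).trans_lt hr₁
  have hp₁ : p ∈ Metric.ball q r₁ := (le_max_left _ _).trans_lt hr₁
  have hz₁ : z ∈ Metric.ball q r₁ := (le_max_right _ _).trans_lt hr₁
  let χ : ContDiffBump q := ⟨r₁, r, hr₁pos, hr₁r⟩
  set U : (Fin (m + 1) → ℝ) → 𝔸 := fun x => χ x • u x with hU
  have hUsmooth : ContDiff ℝ 1 U := χ.contDiff.smul hu
  have hUc : HasCompactSupport U := χ.hasCompactSupport.smul_right
  have hUu : ∀ x ∈ Metric.ball q r₁, U =ᶠ[nhds x] u := fun x hx => by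
    filter_upwards [Metric.isOpen_ball.mem_nhds hx] with y hy
    rw [hU]
    simp only
    rw [χ.one_of_mem_closedBall (Metric.ball_subset_closedBall hy), one_smul]
  have hh : Continuous (dbarOne H U) := continuous_dbarOne H hUsmooth
  have hhc : HasCompactSupport (dbarOne H U) := hasCompactSupport_dbarOne H hUc
  have hh0 : ∀ x ∈ Metric.ball q r₁, dbarOne H U x = 0 := fun x hx => by
    rw [dbarOne_congr H (hUu x hx), hd x (Metric.ball_subset_ball hr₁r.le hx)]
  have hseg : ∀ t ∈ Set.Icc (0 : ℝ) 1, p + t • (z - p) ∈ Metric.ball q r₁ := fun t ht =>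
    (convex_ball q r₁).add_smul_sub_mem hp₁ hz₁ ht
  rw [← (hUu z hz₁).eq_of_nhds, ← Module.forall_dual_apply_eq_zero_iff ℝ]
  intro l
  have han : AnalyticOnNhd ℝ (fun t : ℝ => l (U (p + t • (z - p)))) (Set.Icc 0 1) := by
    have := analyticOnNhd_apply_cauchyTransform_segment H hh hhc Metric.isOpen_ball hh0 hseg l
    simpa only [cauchyTransform_dbarOne H hUsmooth hUc] using this
  have hzero : (fun t : ℝ => l (U (p + t • (z - p)))) =ᶠ[nhds 0] 0 := by
    have hc : Filter.Tendsto (fun t : ℝ => p + t • (z - p)) (nhds 0) (nhds p) := by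
      have : Continuous fun t : ℝ => p + t • (z - p) := by fun_prop
      simpa using this.tendsto 0
    filter_upwards [hc.eventually ((hUu p hp₁).trans h0)] with t ht
    simp [ht]
  have := han.eqOn_zero_of_preconnected_of_eventuallyEq_zero isPreconnected_Icc
    (Set.left_mem_Icc.2 zero_le_one) hzero (Set.right_mem_Icc.2 zero_le_one)
  simpa using this

/-! ### The solution operator -/

theorem contDiff_update_prod (k : ℕ∞) (i : Fin n) :
    ContDiff ℝ k fun z : Mn n m × (Fin (m + 1) → ℝ) => Function.update z.1 i z.2 := by
  refine contDiff_pi.2 fun j => ?_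
  rcases eq_or_ne j i with rfl | hj
  · simpa using contDiff_snd
  · simp only [Function.update_of_ne hj]
    fun_prop

theorem hasCompactSupport_comp_update {E : Type*} [Zero E] {h : Mn n m → E} (hc : HasCompactSupport h)
    (x : Mn n m) (i : Fin n) : HasCompactSupport fun y => h (Function.update x i y) := by
  refine HasCompactSupport.intro (K := (fun z : Mn n m => z i) '' tsupport h)
    (hc.isCompact.image (by fun_prop)) fun y hy => image_eq_zero_of_notMem_tsupport fun hmem => ?_
  exact hy ⟨_, hmem, by simp⟩

theorem integral_mul_cauchyE (H : HCAlg 𝔸 m) {h : (Fin (m + 1) → ℝ) → 𝔸} (hh : Continuous h)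
    (hc : HasCompactSupport h) :
    ∫ y, H.mul (CauchyE H y) (h y) =
      ∑ s, H.mul (H.conj (H.v s)) (∫ y, cauchyComp s y • h y) := by
  have := H.findim
  have := FiniteDimensional.complete ℝ 𝔸
  let T : Fin (m + 1) → 𝔸 →L[ℝ] 𝔸 := fun s =>
    (H.mul (H.conj (H.v s))).toContinuousLinearMap
  have hint := fun s => integrable_cauchyComp_smul s hh hc
  have heq : ∀ y, H.mul (CauchyE H y) (h y) = ∑ s, T s (cauchyComp s y • h y) := fun y => by
    simp [CauchyE_eq_sum, T, LinearMap.sum_apply]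
  simp only [heq]
  rw [integral_finsetSum _ fun s _ => (T s).integrable_comp (hint s)]
  exact Finset.sum_congr rfl fun s _ => (T s).integral_comp_comm (hint s)

theorem Tsol_eq_neg_Fint (H : HCAlg 𝔸 m) (hn : 0 < n) (g : Mn n m → 𝔸) (x : Mn n m) :
    Tsol H hn g x = -Fint H hn g x := by
  rw [Tsol, Fint, ← integral_add_right_eq_self _ (x ⟨0, hn⟩)]
  simp

theorem Tsol_eq_cauchyTransform (H : HCAlg 𝔸 m) (hn : 0 < n) {g : Mn n m → 𝔸}
    (hg : Continuous g) (hc : HasCompactSupport g) (x : Mn n m) :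
    Tsol H hn g x =
      cauchyTransform H (fun y => g (Function.update x ⟨0, hn⟩ y)) (x ⟨0, hn⟩) := by
  have hcont : Continuous fun y => g (Function.update x ⟨0, hn⟩ y) := by fun_prop
  have hcs := hasCompactSupport_comp_update hc x ⟨0, hn⟩
  set u : (Fin (m + 1) → ℝ) → 𝔸 := fun y => g (Function.update x ⟨0, hn⟩ y)
  have htr : HasCompactSupport fun y => u (y + x ⟨0, hn⟩) :=
    hcs.comp_homeomorph (Homeomorph.addRight (x ⟨0, hn⟩))
  rw [Tsol_eq_neg_Fint, Fint,
    integral_mul_cauchyE H (h := fun y => u (y + x ⟨0, hn⟩)) (by fun_prop) htr, cauchyTransform,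
    ← Finset.sum_neg_distrib]
  refine Finset.sum_congr rfl fun s _ => ?_
  rw [← map_neg, ← integral_neg, cauchyConv_apply, ← integral_neg_eq_self]
  congr 2
  ext y
  rw [cauchyComp_neg, neg_smul, neg_neg, neg_add_eq_sub]

theorem Tsol_update (H : HCAlg 𝔸 m) (hn : 0 < n) {g : Mn n m → 𝔸}
    (hg : Continuous g) (hc : HasCompactSupport g) (x : Mn n m) (y : Fin (m + 1) → ℝ) :
    Tsol H hn g (Function.update x ⟨0, hn⟩ y) =
      cauchyTransform H (fun y => g (Function.update x ⟨0, hn⟩ y)) y := by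
  simp [Tsol_eq_cauchyTransform H hn hg hc]

theorem contDiff_Tsol (H : HCAlg 𝔸 m) (hn : 0 < n) {g : Mn n m → 𝔸} {k : ℕ∞}
    (hg : ContDiff ℝ k g) (hc : HasCompactSupport g) : ContDiff ℝ k (Tsol H hn g) := by
  have := H.findim
  have heq : Tsol H hn g = fun x => ∑ s, (H.mul (H.conj (H.v s))).toContinuousLinearMap
      (cauchyConv s (fun y => g (Function.update x ⟨0, hn⟩ y)) (x ⟨0, hn⟩)) := by
    ext x
    rw [Tsol_eq_cauchyTransform H hn hg.continuous hc]
    rfl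
  rw [heq]
  refine ContDiff.sum fun s _ => (ContinuousLinearMap.contDiff _).comp ?_
  rw [← contDiffOn_univ]
  refine contDiffOn_convolution_right_with_param_comp (ContinuousLinearMap.lsmul ℝ ℝ)
    (v := fun x : Mn n m => x ⟨0, hn⟩)
    (g := fun (x : Mn n m) y => g (Function.update x ⟨0, hn⟩ y))
    (k := (fun z : Mn n m => z ⟨0, hn⟩) '' tsupport g) (by fun_prop) isOpen_univ
    (hc.isCompact.image (by fun_prop)) (fun p y _ hy => ?_) (locallyIntegrable_cauchyComp s) ?_
  · exact image_eq_zero_of_notMem_tsupport fun hmem => hy ⟨_, hmem, by simp⟩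
  · exact (hg.comp (contDiff_update_prod k ⟨0, hn⟩)).contDiffOn

theorem dbar_eq_dbarOne (H : HCAlg 𝔸 m) {f : Mn n m → 𝔸} (hf : Differentiable ℝ f) (j : Fin n)
    (x : Mn n m) : dbar H f j x = dbarOne H (fun y => f (Function.update x j y)) (x j) := by
  refine Finset.sum_congr rfl fun s _ => ?_
  have hd : HasFDerivAt (fun y => f (Function.update x j y)) _ (x j) :=
    (hf (Function.update x j (x j))).hasFDerivAt.comp (x j) (hasFDerivAt_update x (x j))
  rw [pd, pd1, hd.fderiv, Function.update_eq_self, ContinuousLinearMap.comp_apply]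
  congr 2
  ext i
  rcases eq_or_ne i j with rfl | hi
  · simp
  · simp [hi]

theorem dbar_Tsol_zero (H : HCAlg 𝔸 m) (hn : 0 < n) {g : Mn n m → 𝔸}
    (hg : ContDiff ℝ 1 g) (hc : HasCompactSupport g) (x : Mn n m) :
    dbar H (Tsol H hn g) ⟨0, hn⟩ x = g x := by
  have hT : ContDiff ℝ 1 (Tsol H hn g) := contDiff_Tsol H hn (k := 1) hg hc
  rw [dbar_eq_dbarOne H (hT.differentiable one_ne_zero)]
  simp only [Tsol_update H hn hg.continuous hc]
  have h1 : ContDiff ℝ 1 fun y => g (Function.update x ⟨0, hn⟩ y) :=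
    hg.comp (contDiff_update 1 x ⟨0, hn⟩)
  have := dbarOne_cauchyTransform H h1 (hasCompactSupport_comp_update hc x ⟨0, hn⟩) (x ⟨0, hn⟩)
  refine Eq.trans this ?_
  simp

theorem dbar_neg (H : HCAlg 𝔸 m) (f : Mn n m → 𝔸) (j : Fin n) (x : Mn n m) :
    dbar H (fun x => -f x) j x = -dbar H f j x := by
  simp [dbar, pd]

theorem Tsol_eq_zero (H : HCAlg 𝔸 m) (hn : 0 < n) {g : Mn n m → 𝔸} {x : Mn n m}
    (h : ∀ y, g (Function.update x ⟨0, hn⟩ y) = 0) : Tsol H hn g x = 0 := by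
  simp [Tsol, h]

/-! ### Unique continuation in several variables -/

/-- Unique continuation on polydiscs. -/
theorem eq_zero_of_dbar_eq_zero_on_ball (H : HCAlg 𝔸 m) {f : Mn n m → 𝔸} (hf : ContDiff ℝ 1 f)
    {p q : Mn n m} {r : ℝ} (hd : ∀ x ∈ Metric.ball q r, ∀ j, dbar H f j x = 0)
    (hp : p ∈ Metric.ball q r) (h0 : f =ᶠ[nhds p] 0) {z : Mn n m} (hz : z ∈ Metric.ball q r) :
    f z = 0 := by
  have hr : 0 < r := dist_nonneg.trans_lt hp
  obtain ⟨ρ, hρ, hball⟩ := Metric.mem_nhds_iff.1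
    (Filter.inter_mem h0 (Metric.isOpen_ball.mem_nhds hp))
  have key : ∀ S : Finset (Fin n), ∀ x : Mn n m, (∀ j ∈ S, x j ∈ Metric.ball (q j) r) →
      (∀ j ∉ S, x j ∈ Metric.ball (p j) ρ) → f x = 0 := by
    intro S
    induction S using Finset.induction_on with
    | empty =>
      intro x _ hx
      exact (hball ((dist_pi_lt_iff hρ).2 fun j => hx j (Finset.notMem_empty j))).1
    | insert i S hi ih =>
      intro x hS hx
      have hpi : ∀ j, ∀ y ∈ Metric.ball (p j) ρ, y ∈ Metric.ball (q j) r := fun j y hy => by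
        have hmem : Function.update p j y ∈ Metric.ball p ρ := by
          refine (dist_pi_lt_iff hρ).2 fun l => ?_
          rcases eq_or_ne l j with rfl | hl
          · simpa using hy
          · simpa [hl] using hρ
        simpa using (dist_pi_lt_iff hr).1 (hball hmem).2 j
      have hxq : ∀ j, j ≠ i → x j ∈ Metric.ball (q j) r := fun j hj => by
        by_cases hjS : j ∈ S
        · exact hS j (Finset.mem_insert_of_mem hjS)
        · exact hpi j _ (hx j (by simp [hj, hjS]))
      have hupd : ∀ y ∈ Metric.ball (q i) r, Function.update x i y ∈ Metric.ball q r :=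
        fun y hy => (dist_pi_lt_iff hr).2 fun j => by
          rcases eq_or_ne j i with rfl | hj
          · simpa using hy
          · simpa [hj] using hxq j hj
      have hu : ContDiff ℝ 1 fun y => f (Function.update x i y) := hf.comp (contDiff_update 1 x i)
      have hdu : ∀ y ∈ Metric.ball (q i) r, dbarOne H (fun y => f (Function.update x i y)) y = 0 :=
        fun y hy => by
          have := hd _ (hupd y hy) i
          rw [dbar_eq_dbarOne H (hf.differentiable one_ne_zero)] at this
          simpa using this
      have hu0 : (fun y => f (Function.update x i y)) =ᶠ[nhds (p i)] 0 := by
        filter_upwards [Metric.ball_mem_nhds (p i) hρ] with y hy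
        refine ih _ (fun j hj => ?_) fun j hj => ?_
        · rw [Function.update_of_ne (ne_of_mem_of_not_mem hj hi)]
          exact hS j (Finset.mem_insert_of_mem hj)
        · rcases eq_or_ne j i with rfl | hji
          · simpa using hy
          · rw [Function.update_of_ne hji]
            exact hx j (by simp [hji, hj])
      have := eq_zero_of_dbarOne_eq_zero H hu hdu (hpi i _ (Metric.mem_ball_self hρ)) hu0
        (hS i (Finset.mem_insert_self i S))
      simpa using this
  exact key Finset.univ z (fun j _ => (dist_pi_lt_iff hr).1 hz j) fun j hj => by simp at hj

/-- Unique continuation on connected sets. -/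
theorem eqOn_zero_of_dbar_eq_zero (H : HCAlg 𝔸 m) {f : Mn n m → 𝔸} (hf : ContDiff ℝ 1 f)
    {C : Set (Mn n m)} (hC : IsOpen C) (hC' : IsPreconnected C)
    (hd : ∀ x ∈ C, ∀ j, dbar H f j x = 0) {p : Mn n m} (hp : p ∈ C) (h0 : f =ᶠ[nhds p] 0) :
    ∀ x ∈ C, f x = 0 := by
  have hsub : C ⊆ {x | f =ᶠ[nhds x] 0} := by
    refine hC'.subset_of_closure_inter_subset isOpen_setOfPred_eventually_nhds ⟨p, hp, h0⟩ ?_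
    rintro q ⟨hq, hqC⟩
    obtain ⟨r, hr, hball⟩ := Metric.isOpen_iff.1 hC q hqC
    obtain ⟨p', hp', hdist⟩ := Metric.mem_closure_iff.1 hq r hr
    filter_upwards [Metric.ball_mem_nhds q hr] with z hz
    exact eq_zero_of_dbar_eq_zero_on_ball H hf (fun x hx => hd x (hball hx))
      (by rwa [Metric.mem_ball']) hp' hz
  exact fun x hx => (hsub hx).eq_of_nhds

/-- If all `g j` vanish outside a ball of radius `R`, then `Tsol` of `g 0` vanishes at each point
which can be connected, outside of the supports, to a point of norm larger than `R`. -/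
theorem Tsol_eq_zero_of_mem_connectedComponentIn (H : HCAlg 𝔸 m) (hn : 1 < n)
    {g : Mn n m → 𝔸} (hg : ContDiff ℝ 1 g) (hc : HasCompactSupport g)
    {K : Set (Mn n m)} (hK : IsClosed K) {R : ℝ} (hKR : K ⊆ Metric.closedBall 0 R)
    (hgK : ∀ x ∉ K, g x = 0)
    (hd : ∀ x ∉ K, ∀ j, dbar H (Tsol H (zero_lt_one.trans hn) g) j x = 0)
    {x y : Mn n m} (hy : y ∈ connectedComponentIn Kᶜ x) (hyR : R < ‖y‖) :
    Tsol H (zero_lt_one.trans hn) g x = 0 := by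
  have hn0 : 0 < n := zero_lt_one.trans hn
  have hxK : x ∈ Kᶜ := connectedComponentIn_nonempty_iff.1 ⟨y, hy⟩
  have hout : ∀ (z : Mn n m) (j : Fin n), R < ‖z j‖ → z ∉ K := fun z j hz hzK =>
    (hz.trans_le (norm_le_pi_norm z j)).not_ge (mem_closedBall_zero_iff.1 (hKR hzK))
  have huc : ∀ p ∈ connectedComponentIn Kᶜ x, ∀ j, j ≠ ⟨0, hn0⟩ → R < ‖p j‖ →
      Tsol H hn0 g x = 0 := fun p hp j hj hpj => by
    have hev : Tsol H hn0 g =ᶠ[nhds p] 0 := by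
      have hcont : Continuous fun z : Mn n m => ‖z j‖ := by fun_prop
      filter_upwards [hcont.continuousAt.eventually (lt_mem_nhds hpj)] with z hz
      refine Tsol_eq_zero H hn0 fun w => hgK _ (hout _ j ?_)
      rwa [Function.update_of_ne hj]
    exact eqOn_zero_of_dbar_eq_zero H (contDiff_Tsol H hn0 (k := 1) hg hc)
      hK.isOpen_compl.connectedComponentIn isPreconnected_connectedComponentIn
      (fun z hz => hd z (connectedComponentIn_subset _ _ hz)) hp hev x
      (mem_connectedComponentIn hxK)
  obtain ⟨j, hj⟩ : ∃ j, R < ‖y j‖ := by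
    by_contra! h
    rcases le_or_gt 0 R with hR | hR
    · exact hyR.not_ge ((pi_norm_le_iff_of_nonneg hR).2 h)
    · exact ((norm_nonneg (y ⟨0, hn0⟩)).trans (h _)).not_gt hR
  rcases ne_or_eq j ⟨0, hn0⟩ with hj0 | rfl
  · exact huc y hy j hj0 hj
  obtain ⟨c, hcR⟩ := NormedSpace.exists_lt_norm ℝ (Fin (m + 1) → ℝ) R
  have h10 : (⟨1, hn⟩ : Fin n) ≠ ⟨0, hn0⟩ := by simp
  let L : Set (Mn n m) := Set.range (Function.update y ⟨1, hn⟩)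
  have hL : IsPreconnected L := isPreconnected_range (by fun_prop)
  have hLK : L ⊆ Kᶜ := by
    rintro _ ⟨w, rfl⟩
    exact hout _ ⟨0, hn0⟩ (by rwa [Function.update_of_ne h10.symm])
  have hyL : y ∈ L := ⟨y ⟨1, hn⟩, Function.update_eq_self _ _⟩
  refine huc (Function.update y ⟨1, hn⟩ c) ?_ ⟨1, hn⟩ h10 (by simpa using hcR)
  rw [connectedComponentIn_eq hy]
  exact hL.subset_connectedComponentIn hyL hLK ⟨c, rfl⟩

/-- (ii) ⇒ (i) of Theorem 5.2: if `g_j(x) = −∂̄_j (∫_M E(y₁) g₁(y₁ + x₁, x⁰) dV(y₁))`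
for `j = 2, …, n`, then `f(x) = −∫_M E(y₁ − x₁) g₁(y₁, x⁰) dV(y₁)` is a compactly
supported `C^k` solution of the system `∂̄_j f = g_j`, vanishing on the unbounded
connected component of `M^n ∖ (supp g₁ ∪ ⋯ ∪ supp g_n)`. -/
theorem condition_ii_implies_solution (H : HCAlg 𝔸 m) (hn : 1 < n) (k : ℕ) (hk : 3 ≤ k)
    (g : Fin n → Mn n m → 𝔸)
    (hg : ∀ j, ContDiff ℝ k (g j)) (hgs : ∀ j, HasCompactSupport (g j))
    (hii : ∀ j : Fin n, j ≠ ⟨0, by omega⟩ → ∀ x : Mn n m,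
        g j x = - dbar H (Fint H (by omega) (g ⟨0, by omega⟩)) j x) :
    ContDiff ℝ k (Tsol H (by omega) (g ⟨0, by omega⟩)) ∧
    HasCompactSupport (Tsol H (by omega) (g ⟨0, by omega⟩)) ∧
    (∀ (j : Fin n) (x : Mn n m), dbar H (Tsol H (by omega) (g ⟨0, by omega⟩)) j x = g j x) ∧
    ∀ x ∈ (⋃ j, tsupport (g j))ᶜ,
      ¬ Bornology.IsBounded (connectedComponentIn ((⋃ j, tsupport (g j))ᶜ) x) →
        Tsol H (by omega) (g ⟨0, by omega⟩) x = 0 := by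
  have hn0 : 0 < n := by omega
  have hk1 : (1 : WithTop ℕ∞) ≤ k := by exact_mod_cast (by omega : 1 ≤ k)
  have hg1 := (hg ⟨0, hn0⟩).of_le hk1
  have hdbar : ∀ (j : Fin n) (x : Mn n m),
      dbar H (Tsol H hn0 (g ⟨0, hn0⟩)) j x = g j x := fun j x => by
    rcases eq_or_ne j ⟨0, hn0⟩ with rfl | hj
    · exact dbar_Tsol_zero H hn0 hg1 (hgs _) x
    · rw [hii j hj x, ← dbar_neg, funext (Tsol_eq_neg_Fint H hn0 (g ⟨0, hn0⟩))]
  have hK : IsCompact (⋃ j, tsupport (g j)) := isCompact_iUnion fun j => (hgs j).isCompact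
  have hgK : ∀ x ∉ ⋃ j, tsupport (g j), ∀ j, g j x = 0 := fun x hx j =>
    image_eq_zero_of_notMem_tsupport fun hmem => hx (Set.mem_iUnion_of_mem j hmem)
  obtain ⟨R, hR⟩ := hK.isBounded.subset_closedBall 0
  have hvanish := @Tsol_eq_zero_of_mem_connectedComponentIn _ _ _ m n H hn _ hg1 (hgs _) _
    hK.isClosed R hR (fun x hx => hgK x hx _)
    (fun x hx j => (hdbar j x).trans (hgK x hx j))
  refine ⟨contDiff_Tsol H hn0 (k := k) (hg _) (hgs _), ?_, hdbar, fun x _ hunb => ?_⟩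
  · refine HasCompactSupport.intro (isCompact_closedBall 0 R) fun x hx => ?_
    exact hvanish (mem_connectedComponentIn fun hxK => hx (hR hxK))
      (by simpa [mem_closedBall_zero_iff] using hx)
  · obtain ⟨y, hy, hyR⟩ : ∃ y ∈ connectedComponentIn (⋃ j, tsupport (g j))ᶜ x, R < ‖y‖ := by
      by_contra! h
      exact hunb (Metric.isBounded_closedBall.subset fun y hy =>
        mem_closedBall_zero_iff.2 (h y hy))
    exact hvanish hy hyR

end
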